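/- Let X, Y, Y₀ be infinite-dimensional real Banach spaces with Y₀ a closed subspace of Y, let S ⊆ X, let T be a uniform quotient map from S onto Y which is Lipschitz for large distances, and let P be a bounded linear projection from Y onto Y₀. Then for all t ∈ (0,1], (2/3)·β̄_X(C^T t / (12‖P‖L₁^T)) ≤ ρ̄_{Y₀}(t). -/

import Mathlib

open Set Metric Filter Topology

noncomputable section

/-- `T` is a uniform quotient map on `S`: uniformly continuous and co-uniformly
continuous (with closed balls). -/
def UniformQuotientOn {X Y : Type*} [NormedAddCommGroup X] [NormedAddCommGroup Y]
    (T : X → Y) (S : Set X) : Prop :=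
  (∀ ε > 0, ∃ δ > 0, ∀ x ∈ S, ∀ x' ∈ S, ‖x - x'‖ ≤ δ → ‖T x - T x'‖ ≤ ε) ∧
  (∀ ε > 0, ∃ δ > 0, ∀ x ∈ S, closedBall (T x) δ ⊆ T '' (closedBall x ε ∩ S))

/-- The set of ratios `‖Tx - Tx'‖ / ‖x - x'‖` over pairs of points of `S` at distance `≥ d`. -/
def LargeDistRatioSet {X Y : Type*} [NormedAddCommGroup X] [NormedAddCommGroup Y]
    (T : X → Y) (S : Set X) (d : ℝ) : Set ℝ :=
  {r | ∃ x ∈ S, ∃ x' ∈ S, d ≤ ‖x - x'‖ ∧ r = ‖T x - T x'‖ / ‖x - x'‖}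

/-- `L_d^T`, the Lipschitz constant of `T` for distances `≥ d`. -/
noncomputable def Ld {X Y : Type*} [NormedAddCommGroup X] [NormedAddCommGroup Y]
    (T : X → Y) (S : Set X) (d : ℝ) : ℝ :=
  sSup (LargeDistRatioSet T S d)

/-- `T` is Lipschitz for large distances: `L_d^T < ∞` for every `d > 0`. -/
def LipschitzLargeDist {X Y : Type*} [NormedAddCommGroup X] [NormedAddCommGroup Y]
    (T : X → Y) (S : Set X) : Prop :=
  ∀ d > 0, BddAbove (LargeDistRatioSet T S d)

/-- The set of co-Lipschitz constants valid for all radii `r ≥ d`. -/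
def CoLipSet {X Y : Type*} [NormedAddCommGroup X] [NormedAddCommGroup Y]
    (T : X → Y) (S : Set X) (d : ℝ) : Set ℝ :=
  {c | 0 < c ∧ ∀ r, d ≤ r → ∀ x ∈ S, ∀ y : Y, ‖y - T x‖ < c * r →
      y ∈ T '' (closedBall x r ∩ S)}

/-- `c_d^T`. -/
noncomputable def cdT {X Y : Type*} [NormedAddCommGroup X] [NormedAddCommGroup Y]
    (T : X → Y) (S : Set X) (d : ℝ) : ℝ :=
  sSup (CoLipSet T S d)

/-- `C^T = lim_{d → ∞} c_d^T` (the limit of the nondecreasing family `c_d^T`,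
i.e. its supremum). -/
noncomputable def CT {X Y : Type*} [NormedAddCommGroup X] [NormedAddCommGroup Y]
    (T : X → Y) (S : Set X) : ℝ :=
  sSup {c | ∃ d, 0 < d ∧ c = cdT T S d}

/-- The set of admissible `δ`'s in the definition of the modulus `β̄_X(t)`. -/
def betaModSet (X : Type*) [NormedAddCommGroup X] (t : ℝ) : Set ℝ :=
  {δ | 0 ≤ δ ∧ ∀ x ∈ closedBall (0 : X) 1, ∀ xs : ℕ → X,
      (∀ n, xs n ∈ closedBall (0 : X) 1) →
      (∀ m n, m ≠ n → t ≤ ‖xs m - xs n‖) →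
      ∃ n, ‖x - xs n‖ / 2 ≤ 1 - δ}

/-- The modulus `β̄_X(t)` of property (β) of Rolewicz. -/
noncomputable def betaMod (X : Type*) [NormedAddCommGroup X] (t : ℝ) : ℝ :=
  sSup (betaModSet X t)

/-- Property (β) of Rolewicz. -/
def PropertyBeta (X : Type*) [NormedAddCommGroup X] : Prop :=
  ∃ a, 1 ≤ a ∧ a ≤ 2 ∧ ∀ t, 0 < t → t ≤ a → ∃ δ, 0 < δ ∧
    ∀ x ∈ closedBall (0 : X) 1, ∀ xs : ℕ → X,
      (∀ n, xs n ∈ closedBall (0 : X) 1) →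
      (∀ m n, m ≠ n → t ≤ ‖xs m - xs n‖) →
      ∃ n, ‖x - xs n‖ / 2 ≤ 1 - δ

/-- `Z` is a closed subspace of finite codimension. -/
def FinCodim {Y : Type*} [NormedAddCommGroup Y] [NormedSpace ℝ Y] (Z : Subspace ℝ Y) : Prop :=
  IsClosed (Z : Set Y) ∧ FiniteDimensional ℝ (Y ⧸ Z)

/-- `ρ̄_Y(t, y) = inf_Z sup_{z ∈ S_Z} (‖y + tz‖ - 1)`. -/
noncomputable def rhoAt {Y : Type*} [NormedAddCommGroup Y] [NormedSpace ℝ Y]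
    (t : ℝ) (y : Y) : ℝ :=
  sInf {s | ∃ Z : Subspace ℝ Y, FinCodim Z ∧
    s = sSup {r | ∃ z ∈ Z, ‖z‖ = 1 ∧ r = ‖y + t • z‖ - 1}}

/-- The modulus of asymptotic uniform smoothness `ρ̄_Y(t)`. -/
noncomputable def rhoMod (Y : Type*) [NormedAddCommGroup Y] [NormedSpace ℝ Y] (t : ℝ) : ℝ :=
  sSup {r | ∃ y : Y, ‖y‖ = 1 ∧ r = rhoAt t y}

/-- `δ̄_Y(t, y) = sup_Z inf_{z ∈ S_Z} (‖y + tz‖ - 1)`. -/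
noncomputable def deltaAt {Y : Type*} [NormedAddCommGroup Y] [NormedSpace ℝ Y]
    (t : ℝ) (y : Y) : ℝ :=
  sSup {s | ∃ Z : Subspace ℝ Y, FinCodim Z ∧
    s = sInf {r | ∃ z ∈ Z, ‖z‖ = 1 ∧ r = ‖y + t • z‖ - 1}}

/-- The modulus of asymptotic uniform convexity `δ̄_Y(t)`. -/
noncomputable def deltaMod (Y : Type*) [NormedAddCommGroup Y] [NormedSpace ℝ Y] (t : ℝ) : ℝ :=
  sInf {r | ∃ y : Y, ‖y‖ = 1 ∧ r = deltaAt t y}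

/-- The norm of `Y` is asymptotically uniformly smooth. -/
def AUS (Y : Type*) [NormedAddCommGroup Y] [NormedSpace ℝ Y] : Prop :=
  Tendsto (fun t => rhoMod Y t / t) (𝓝[>] 0) (𝓝 0)

/-- The norm of `Y` is asymptotically uniformly convex. -/
def AUC (Y : Type*) [NormedAddCommGroup Y] [NormedSpace ℝ Y] : Prop :=
  ∀ t > 0, 0 < deltaMod Y t

/-- A sequence is basic with basis constant at most `K`. -/
def IsBasicWithConst {Y : Type*} [NormedAddCommGroup Y] [NormedSpace ℝ Y]
    (K : ℝ) (e : ℕ → Y) : Prop :=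
  ∀ (a : ℕ → ℝ) (m n : ℕ), m ≤ n →
    ‖∑ i ∈ Finset.range m, a i • e i‖ ≤ K * ‖∑ i ∈ Finset.range n, a i • e i‖

/-- A weakly null sequence. -/
def WeaklyNull {Y : Type*} [NormedAddCommGroup Y] [NormedSpace ℝ Y] (xs : ℕ → Y) : Prop :=
  ∀ f : Y →L[ℝ] ℝ, Tendsto (fun n => f (xs n)) atTop (𝓝 0)

/-- Property (M) of Kalton. -/
def PropertyM (Y : Type*) [NormedAddCommGroup Y] [NormedSpace ℝ Y] : Prop :=
  ∀ u v : Y, ‖u‖ = 1 → ‖v‖ = 1 → ∀ xs : ℕ → Y, WeaklyNull xs →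
    limsup (fun n => ‖u + xs n‖) atTop = limsup (fun n => ‖v + xs n‖) atTop

/-- `N` is a norm on `X` equivalent to the given one. -/
def IsEquivNorm {X : Type*} [NormedAddCommGroup X] [NormedSpace ℝ X] (N : X → ℝ) : Prop :=
  (∀ x y, N (x + y) ≤ N x + N y) ∧
  (∀ (a : ℝ) (x : X), N (a • x) = |a| * N x) ∧
  (∃ c > 0, ∃ C > 0, ∀ x : X, c * ‖x‖ ≤ N x ∧ N x ≤ C * ‖x‖)

/-- The norm `N` has property (β) of Rolewicz. -/
def NormHasPropertyBeta {X : Type*} [NormedAddCommGroup X] (N : X → ℝ) : Prop :=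
  ∃ a, 1 ≤ a ∧ a ≤ 2 ∧ ∀ t, 0 < t → t ≤ a → ∃ δ, 0 < δ ∧
    ∀ x : X, N x ≤ 1 → ∀ xs : ℕ → X, (∀ n, N (xs n) ≤ 1) →
      (∀ m n, m ≠ n → t ≤ N (xs m - xs n)) →
      ∃ n, N (x - xs n) / 2 ≤ 1 - δ

theorem aux_bdd {F : Type*} [NormedAddCommGroup F] [NormedSpace ℝ F] (t : ℝ) (ht : 0 < t) (y : F)
    (hy : ‖y‖ = 1) (Z : Subspace ℝ F) :
    t ∈ upperBounds {r | ∃ z ∈ Z, ‖z‖ = 1 ∧ r = ‖y + t • z‖ - 1} := by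
  rintro r ⟨z, -, hz, rfl⟩
  have := norm_add_le y (t • z)
  rw [norm_smul, hz, hy, Real.norm_of_nonneg ht.le] at this
  linarith

theorem aux_sup_nonneg {F : Type*} [NormedAddCommGroup F] [NormedSpace ℝ F] (t : ℝ) (ht : 0 < t)
    (y : F) (hy : ‖y‖ = 1) (Z : Subspace ℝ F) :
    0 ≤ sSup {r | ∃ z ∈ Z, ‖z‖ = 1 ∧ r = ‖y + t • z‖ - 1} := by
  by_cases h : ∃ z ∈ Z, ‖z‖ = 1
  · obtain ⟨z, hzZ, hz⟩ := h
    have h1 := le_csSup ⟨t, aux_bdd t ht y hy Z⟩ (⟨z, hzZ, hz, rfl⟩ :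
      ‖y + t • z‖ - 1 ∈ {r | ∃ z ∈ Z, ‖z‖ = 1 ∧ r = ‖y + t • z‖ - 1})
    have h2 := le_csSup ⟨t, aux_bdd t ht y hy Z⟩ (⟨-z, Z.neg_mem hzZ, by rwa [norm_neg], rfl⟩ :
      ‖y + t • (-z)‖ - 1 ∈ {r | ∃ z ∈ Z, ‖z‖ = 1 ∧ r = ‖y + t • z‖ - 1})
    have h3 := norm_add_le (y + t • z) (y + t • (-z))
    have h4 : (y + t • z) + (y + t • (-z)) = (2 : ℝ) • y := by module
    rw [h4, norm_smul, hy] at h3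
    norm_num at h3
    rw [smul_neg] at h2
    linarith
  · apply Real.sSup_nonneg
    rintro r ⟨z, hzZ, hz, -⟩
    exact absurd ⟨z, hzZ, hz⟩ h

theorem aux_rhoAt_nonneg {F : Type*} [NormedAddCommGroup F] [NormedSpace ℝ F] (t : ℝ) (ht : 0 < t)
    (y : F) (hy : ‖y‖ = 1) : 0 ≤ rhoAt t y := by
  apply Real.sInf_nonneg
  rintro s ⟨Z, -, rfl⟩
  exact aux_sup_nonneg t ht y hy Z

theorem aux_finCodim_top {F : Type*} [NormedAddCommGroup F] [NormedSpace ℝ F] :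
    FinCodim (⊤ : Subspace ℝ F) := by
  refine ⟨by simp, ?_⟩
  infer_instance

theorem aux_rhoAt_le {F : Type*} [NormedAddCommGroup F] [NormedSpace ℝ F] (t : ℝ) (ht : 0 < t)
    (y : F) (hy : ‖y‖ = 1) : rhoAt t y ≤ t := by
  have hm : sSup {r | ∃ z ∈ (⊤ : Subspace ℝ F), ‖z‖ = 1 ∧ r = ‖y + t • z‖ - 1} ∈
      {s | ∃ Z : Subspace ℝ F, FinCodim Z ∧
        s = sSup {r | ∃ z ∈ Z, ‖z‖ = 1 ∧ r = ‖y + t • z‖ - 1}} := ⟨⊤, aux_finCodim_top, rfl⟩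
  refine (csInf_le ⟨0, ?_⟩ hm).trans ?_
  · rintro s ⟨Z, -, rfl⟩
    exact aux_sup_nonneg t ht y hy Z
  · exact Real.sSup_le (aux_bdd t ht y hy ⊤) ht.le

theorem aux_rhoMod_nonneg (F : Type*) [NormedAddCommGroup F] [NormedSpace ℝ F] (t : ℝ)
    (ht : 0 < t) : 0 ≤ rhoMod F t := by
  apply Real.sSup_nonneg
  rintro r ⟨y, hy, rfl⟩
  exact aux_rhoAt_nonneg t ht y hy

theorem aux_rhoMod_le (F : Type*) [NormedAddCommGroup F] [NormedSpace ℝ F] (t : ℝ)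
    (ht : 0 < t) : rhoMod F t ≤ t := by
  apply Real.sSup_le _ ht.le
  rintro r ⟨y, hy, rfl⟩
  exact aux_rhoAt_le t ht y hy

theorem aux_rhoAt_le_mod {F : Type*} [NormedAddCommGroup F] [NormedSpace ℝ F] (t : ℝ)
    (ht : 0 < t) (y : F) (hy : ‖y‖ = 1) : rhoAt t y ≤ rhoMod F t := by
  refine le_csSup ⟨t, ?_⟩ ⟨y, hy, rfl⟩
  rintro r ⟨y, hy, rfl⟩
  exact aux_rhoAt_le t ht y hy

/-- Sequence of fork tips. -/
theorem aux_seq {F : Type*} [NormedAddCommGroup F] [NormedSpace ℝ F]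
    (hF : ¬ FiniteDimensional ℝ F) (t : ℝ) (ht : 0 < t) (u : F) (hu : ‖u‖ = 1)
    (a : ℝ) (ha : rhoMod F t < a) :
    ∃ z : ℕ → F, (∀ m n, m ≠ n → 1 / 2 ≤ ‖z m - z n‖) ∧
      (∀ n, ‖u + t • z n‖ < 1 + a) ∧ (∀ n, ‖u - t • z n‖ < 1 + a) := by
  have h0 := aux_rhoMod_nonneg F t ht
  have h1 : rhoAt t u < a := (aux_rhoAt_le_mod t ht u hu).trans_lt ha
  obtain ⟨s, ⟨Z, hZ, rfl⟩, hs⟩ := exists_lt_of_csInf_lt (by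
    exact ⟨_, ⟨⊤, aux_finCodim_top, rfl⟩⟩) h1
  have hb : ∀ z ∈ Z, ‖z‖ = 1 → ‖u + t • z‖ < 1 + a := by
    intro z hz hz1
    have := le_csSup ⟨t, aux_bdd t ht u hu Z⟩ (⟨z, hz, hz1, rfl⟩ :
      ‖u + t • z‖ - 1 ∈ {r | ∃ z ∈ Z, ‖z‖ = 1 ∧ r = ‖u + t • z‖ - 1})
    linarith
  have hb' : ∀ z ∈ Z, ‖z‖ ≤ 1 → ‖u + t • z‖ < 1 + a := by
    intro z hz hz1
    rcases eq_or_ne z 0 with rfl | hne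
    · simp [hu]; linarith
    have hp : 0 < ‖z‖ := norm_pos_iff.2 hne
    have e1 : ‖‖z‖⁻¹ • z‖ = 1 := by
      rw [norm_smul, norm_inv, norm_norm]; field_simp
    have i1 := hb _ (Z.smul_mem ‖z‖⁻¹ hz) e1
    have i2 := hb _ (Z.neg_mem (Z.smul_mem ‖z‖⁻¹ hz)) (by rwa [norm_neg])
    have e : u + t • z = ((1 + ‖z‖) / 2) • (u + t • (‖z‖⁻¹ • z)) +
        ((1 - ‖z‖) / 2) • (u + t • (-(‖z‖⁻¹ • z))) := by
      match_scalars
      · ring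
      · field_simp; ring
    rw [e]
    refine (norm_add_le _ _).trans_lt ?_
    rw [norm_smul, norm_smul, Real.norm_of_nonneg (by linarith), Real.norm_of_nonneg (by linarith)]
    nlinarith
  have hZi : ¬ FiniteDimensional ℝ Z := by
    intro h
    have := hZ.2
    exact hF (Module.Finite.of_submodule_quotient Z)
  obtain ⟨f, hf1, hf2⟩ := exists_seq_norm_le_one_le_norm_sub' (𝕜 := ℝ) (E := Z) (c := (3/2 : ℝ))
    (R := 2) (by norm_num) (by norm_num) hZi
  refine ⟨fun n => (1 / 2 : ℝ) • (f n : F), ?_, ?_, ?_⟩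
  · intro m n hmn
    have := hf2 hmn
    rw [← smul_sub, norm_smul, ← Submodule.coe_sub, ← Submodule.coe_norm,
      Real.norm_of_nonneg (by norm_num)]
    simp only at this
    linarith
  · intro n
    refine hb' _ (Z.smul_mem _ (f n).2) ?_
    have : ‖(f n : F)‖ ≤ 2 := hf1 n
    rw [norm_smul]
    norm_num; linarith
  · intro n
    have : u - t • (1 / 2 : ℝ) • (f n : F) = u + t • ((-1 / 2 : ℝ) • (f n : F)) := by module
    rw [this]
    refine hb' _ (Z.smul_mem _ (f n).2) ?_
    have : ‖(f n : F)‖ ≤ 2 := hf1 n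
    rw [norm_smul]
    norm_num; linarith

/-- The fork argument, for fixed error `η`. -/
theorem aux_fork {X F : Type*} [NormedAddCommGroup X] [NormedSpace ℝ X]
    [NormedAddCommGroup F] [NormedSpace ℝ F] (hF : ¬ FiniteDimensional ℝ F)
    (S : Set X) (U : X → F) (L M : ℝ) (hL : 0 < L) (hM : 0 ≤ M)
    (hU1 : ∀ x ∈ S, ∀ x' ∈ S, 1 ≤ ‖x - x'‖ → ‖U x - U x'‖ ≤ L * ‖x - x'‖)
    (hU2 : ∀ x ∈ S, ∀ x' ∈ S, ‖x - x'‖ < 1 → ‖U x - U x'‖ ≤ M)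
    (C : ℝ) (hC : 0 < C) (t : ℝ) (ht : 0 < t) (ht1 : t ≤ 1)
    (s δ : ℝ) (hs : s ≤ C * t / (12 * L)) (hδ : δ ∈ betaModSet X s)
    (η : ℝ) (hη : 0 < η) (hη1 : η ≤ 1 / 2)
    (d c : ℝ) (hd : 0 < d) (hc : c ∈ CoLipSet U S d) (hcC : C * (1 - η) ≤ c)
    (hfail : ∀ D, 0 < D → (1 + η) * C ∉ CoLipSet U S D) :
    3 * (1 - η) ≤ (3 - 2 * δ) * (1 + η) * (1 + rhoMod F t + η) := by
  obtain ⟨hc0, hcl⟩ := hc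
  have hρ0 := aux_rhoMod_nonneg F t ht
  have hρ1 := aux_rhoMod_le F t ht
  set ρ := rhoMod F t with hρ
  have hD : 0 < 3 * d + 6 * (M + 1) / (c * t) := by positivity
  have hf := hfail _ hD
  simp only [CoLipSet, mem_ofPred_eq, not_and, not_forall] at hf
  obtain ⟨r, hr, x, hx, y, hy, hyn⟩ := hf (by positivity)
  have hq : 0 < 6 * (M + 1) / (c * t) := by positivity
  have hr0 : 0 < r := by linarith
  have hR : c * r ≤ ‖y - U x‖ := by
    by_contra hlt
    exact hyn (hcl r (by linarith) x hx y (not_le.1 hlt))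
  set R := ‖y - U x‖ with hRdef
  have hR0 : 0 < R := lt_of_lt_of_le (by positivity) hR
  have hRM : M < R * t / 6 := by
    have h1 : 6 * (M + 1) / (c * t) ≤ r := by linarith
    rw [div_le_iff₀ (by positivity)] at h1
    nlinarith
  obtain ⟨u, hu, huy⟩ : ∃ u : F, ‖u‖ = 1 ∧ y = U x + R • u := by
    refine ⟨R⁻¹ • (y - U x), ?_, ?_⟩
    · rw [norm_smul, ← hRdef, norm_inv, Real.norm_of_nonneg hR0.le]; field_simp
    · rw [smul_smul, mul_inv_cancel₀ hR0.ne']; simp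
  obtain ⟨z, hzs, hz1, hz2⟩ := aux_seq hF t ht u hu (ρ + η) (by linarith)
  set r1 := R / 3 * (1 + ρ + η) / c with hr1
  have hcr1 : c * r1 = R / 3 * (1 + ρ + η) := by rw [hr1]; field_simp
  have hr1d : d ≤ r1 := by
    have : c * d ≤ c * r1 := by rw [hcr1]; nlinarith
    exact le_of_mul_le_mul_left this hc0
  have hr10 : 0 < r1 := by linarith
  -- the fork point
  obtain ⟨w, ⟨hwx, hwS⟩, hUw⟩ := hcl r1 hr1d x hx (U x + (R / 3) • u) (by
    rw [add_sub_cancel_left, norm_smul, hu, Real.norm_of_nonneg (by positivity), hcr1]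
    nlinarith)
  -- the tips
  have htip : ∀ n, ∃ v ∈ S, ‖v - w‖ ≤ r1 ∧ U v = U x + (2 * R / 3) • u + (R / 3 * t) • z n := by
    intro n
    obtain ⟨v, ⟨hv, hvS⟩, hUv⟩ := hcl r1 hr1d w hwS (U x + (2 * R / 3) • u + (R / 3 * t) • z n) (by
      have : U x + (2 * R / 3) • u + (R / 3 * t) • z n - U w = (R / 3) • (u + t • z n) := by
        rw [hUw]; module
      rw [this, norm_smul, Real.norm_of_nonneg (by positivity), hcr1]
      have := hz1 n
      gcongr; linarith)
    exact ⟨v, hvS, by rwa [mem_closedBall, dist_eq_norm] at hv, hUv⟩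
  choose v hvS hvw hUv using htip
  rw [mem_closedBall, dist_eq_norm] at hwx
  have hsep : ∀ m n, m ≠ n → s * r1 ≤ ‖v m - v n‖ := by
    intro m n hmn
    have e1 : U (v m) - U (v n) = (R / 3 * t) • (z m - z n) := by
      rw [hUv, hUv]; module
    have e2 : R * t / 6 ≤ ‖U (v m) - U (v n)‖ := by
      rw [e1, norm_smul, Real.norm_of_nonneg (by positivity)]
      have := mul_le_mul_of_nonneg_left (hzs m n hmn) (by positivity : 0 ≤ R / 3 * t)
      linarith
    have e3 : 1 ≤ ‖v m - v n‖ := by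
      by_contra h
      have := hU2 _ (hvS m) _ (hvS n) (not_le.1 h)
      linarith
    have e4 := hU1 _ (hvS m) _ (hvS n) e3
    have e5 : R * t / 6 ≤ L * ‖v m - v n‖ := e2.trans e4
    have e6 : s * r1 ≤ C * t / (12 * L) * r1 := by gcongr
    have e7 : C ≤ 2 * c := by nlinarith
    have e8 : C * r1 ≤ 2 * R := by
      have : C * r1 ≤ 2 * (c * r1) := by nlinarith
      rw [hcr1] at this
      nlinarith
    have e9 : C * t / (12 * L) * r1 ≤ R * t / 6 / L := by
      rw [div_mul_eq_mul_div, div_div, div_le_div_iff₀ (by positivity) (by positivity)]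
      have := mul_le_mul_of_nonneg_right e8 (by positivity : 0 ≤ t * L * 6)
      nlinarith
    have e10 : R * t / 6 / L ≤ ‖v m - v n‖ := by
      rw [div_le_iff₀ hL]; linarith
    linarith
  have hball : ∀ q : X, ‖q - w‖ ≤ r1 → r1⁻¹ • (q - w) ∈ closedBall (0 : X) 1 := by
    intro q hq
    rw [mem_closedBall_zero_iff, norm_smul, norm_inv, Real.norm_of_nonneg hr10.le,
      inv_mul_le_iff₀ hr10]
    linarith
  obtain ⟨n, hn⟩ := hδ.2 (r1⁻¹ • (x - w)) (hball x (by rwa [norm_sub_rev]))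
    (fun n => r1⁻¹ • (v n - w)) (fun n => hball _ (hvw n)) (by
      intro m n hmn
      rw [← smul_sub, sub_sub_sub_cancel_right, norm_smul, norm_inv, Real.norm_of_nonneg hr10.le,
        le_inv_mul_iff₀ hr10, mul_comm]
      exact hsep m n hmn)
  rw [← smul_sub, sub_sub_sub_cancel_right, norm_smul, norm_inv, Real.norm_of_nonneg hr10.le,
    div_le_iff₀ (by norm_num), inv_mul_le_iff₀ hr10] at hn
  obtain ⟨p, ⟨hp, hpS⟩, hUp⟩ := hcl r1 hr1d (v n) (hvS n) y (by
    have : y - U (v n) = (R / 3) • (u - t • z n) := by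
      rw [hUv]; nth_rw 1 [huy]; module
    rw [this, norm_smul, Real.norm_of_nonneg (by positivity), hcr1]
    have := hz2 n
    gcongr; linarith)
  rw [mem_closedBall, dist_eq_norm] at hp
  have hpx : r < ‖p - x‖ := by
    by_contra h
    exact hyn ⟨p, ⟨by rw [mem_closedBall, dist_eq_norm]; exact not_lt.1 h, hpS⟩, hUp⟩
  have htri : ‖p - x‖ ≤ ‖p - v n‖ + ‖x - v n‖ := by
    rw [norm_sub_rev x]; exact norm_sub_le_norm_sub_add_norm_sub p (v n) x
  have hfin : r < (3 - 2 * δ) * r1 := by linarith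
  have h3δ : 0 < 3 - 2 * δ := pos_of_mul_pos_left (hr0.trans hfin) hr10.le
  have k1 : c * r < (3 - 2 * δ) * (R / 3 * (1 + ρ + η)) := by
    rw [← hcr1]
    have := mul_lt_mul_of_pos_left hfin hc0
    linarith
  have k2 : (3 - 2 * δ) * (R / 3 * (1 + ρ + η)) ≤
      (3 - 2 * δ) * ((1 + η) * C * r / 3 * (1 + ρ + η)) := by gcongr
  have k3 : C * (1 - η) * r ≤ c * r := by gcongr
  have k4 : (C * r / 3) * (3 * (1 - η)) ≤
      (C * r / 3) * ((3 - 2 * δ) * (1 + η) * (1 + ρ + η)) := by linarith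
  exact le_of_mul_le_mul_left k4 (by positivity)

theorem aux_core {X F : Type*} [NormedAddCommGroup X] [NormedSpace ℝ X]
    [NormedAddCommGroup F] [NormedSpace ℝ F] (hF : ¬ FiniteDimensional ℝ F)
    (S : Set X) (U : X → F) (L M : ℝ) (hL : 0 < L) (hM : 0 ≤ M)
    (hU1 : ∀ x ∈ S, ∀ x' ∈ S, 1 ≤ ‖x - x'‖ → ‖U x - U x'‖ ≤ L * ‖x - x'‖)
    (hU2 : ∀ x ∈ S, ∀ x' ∈ S, ‖x - x'‖ < 1 → ‖U x - U x'‖ ≤ M)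
    (C : ℝ) (hC : 0 < C) (hlub : IsLUB {c | ∃ d, 0 < d ∧ c ∈ CoLipSet U S d} C)
    (t : ℝ) (ht : 0 < t) (ht1 : t ≤ 1)
    (s δ : ℝ) (hs : s ≤ C * t / (12 * L)) (hδ : δ ∈ betaModSet X s) :
    (2 / 3) * δ ≤ rhoMod F t := by
  have key : ∀ η : ℝ, 0 < η → η ≤ 1 / 2 →
      3 * (1 - η) ≤ (3 - 2 * δ) * (1 + η) * (1 + rhoMod F t + η) := by
    intro η hη hη1
    obtain ⟨c, ⟨d, hd, hc⟩, hcC, -⟩ := hlub.exists_between (by nlinarith : C * (1 - η) < C)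
    refine aux_fork hF S U L M hL hM hU1 hU2 C hC t ht ht1 s δ hs hδ η hη hη1 d c hd hc hcC.le ?_
    intro D hD h
    have := hlub.1 ⟨D, hD, h⟩
    nlinarith
  have lim : 3 * (1 - (0:ℝ)) ≤ (3 - 2 * δ) * (1 + 0) * (1 + rhoMod F t + 0) := by
    have c1 : Tendsto (fun η : ℝ => 3 * (1 - η)) (𝓝[>] 0) (𝓝 (3 * (1 - 0))) :=
      ((by fun_prop : Continuous (fun η : ℝ => 3 * (1 - η))).tendsto 0).mono_left
        nhdsWithin_le_nhds
    have c2 : Tendsto (fun η : ℝ => (3 - 2 * δ) * (1 + η) * (1 + rhoMod F t + η)) (𝓝[>] 0)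
        (𝓝 ((3 - 2 * δ) * (1 + 0) * (1 + rhoMod F t + 0))) :=
      ((by fun_prop : Continuous
        (fun η : ℝ => (3 - 2 * δ) * (1 + η) * (1 + rhoMod F t + η))).tendsto 0).mono_left
        nhdsWithin_le_nhds
    refine le_of_tendsto_of_tendsto c1 c2 ?_
    filter_upwards [Ioc_mem_nhdsGT (by norm_num : (0:ℝ) < 1 / 2)] with η hη
    exact key η hη.1 hη.2
  have hρ0 := aux_rhoMod_nonneg F t ht
  have := mul_nonneg hδ.1 hρ0
  nlinarith

/-- Corollary `cor1`. -/
theorem stmt3 {X Y : Type*} [NormedAddCommGroup X] [NormedSpace ℝ X] [CompleteSpace X]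
    [NormedAddCommGroup Y] [NormedSpace ℝ Y] [CompleteSpace Y]
    (hX : ¬ FiniteDimensional ℝ X) (hY : ¬ FiniteDimensional ℝ Y)
    (Y₀ : Subspace ℝ Y) (hY₀closed : IsClosed (Y₀ : Set Y))
    (hY₀ : ¬ FiniteDimensional ℝ Y₀)
    (S : Set X) (T : X → Y) (hsurj : T '' S = Set.univ)
    (hT : UniformQuotientOn T S) (hLip : LipschitzLargeDist T S)
    (P : Y →L[ℝ] Y) (hmem : ∀ y : Y, P y ∈ Y₀) (hproj : ∀ y ∈ Y₀, P y = y) :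
    ∀ t : ℝ, 0 < t → t ≤ 1 →
      (2 / 3) * betaMod X (CT T S * t / (12 * ‖P‖ * Ld T S 1)) ≤ rhoMod Y₀ t := by
  intro t ht ht1
  have hρ0 := aux_rhoMod_nonneg Y₀ t ht
  suffices H : ∀ δ ∈ betaModSet X (CT T S * t / (12 * ‖P‖ * Ld T S 1)),
      2 / 3 * δ ≤ rhoMod Y₀ t by
    have : betaMod X (CT T S * t / (12 * ‖P‖ * Ld T S 1)) ≤ 3 / 2 * rhoMod Y₀ t := by
      apply Real.sSup_le _ (by positivity)
      intro δ hδ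
      have := H δ hδ
      linarith
    linarith
  intro δ hδ
  have hLd0 : 0 ≤ Ld T S 1 := by
    apply Real.sSup_nonneg
    rintro r ⟨x, -, x', -, -, rfl⟩
    positivity
  rcases le_or_gt (CT T S * t / (12 * ‖P‖ * Ld T S 1)) 0 with hs | hs
  · have : Nontrivial X := by
      by_contra h
      rw [not_nontrivial_iff_subsingleton] at h
      exact hX inferInstance
    obtain ⟨x, hx⟩ := exists_norm_eq X (zero_le_one : (0:ℝ) ≤ 1)
    obtain ⟨n, hn⟩ := hδ.2 x (by simp [hx]) (fun _ => -x) (by simp [hx]) (by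
      intro m n _; simpa using hs)
    have e : x - -x = (2 : ℝ) • x := by module
    rw [e, norm_smul, hx] at hn
    norm_num at hn
    linarith
  have hPL : 0 < ‖P‖ * Ld T S 1 := by
    refine lt_of_le_of_ne (by positivity) ?_
    intro h
    rw [mul_assoc, ← h] at hs
    simp at hs
  have hCT : 0 < CT T S := by
    by_contra h
    have : CT T S * t / (12 * ‖P‖ * Ld T S 1) ≤ 0 := by
      apply div_nonpos_of_nonpos_of_nonneg
      · nlinarith
      · positivity
    linarith
  -- Lipschitz estimates for `T`
  have hT1 : ∀ x ∈ S, ∀ x' ∈ S, 1 ≤ ‖x - x'‖ → ‖T x - T x'‖ ≤ Ld T S 1 * ‖x - x'‖ := by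
    intro x hx x' hx' h
    have := le_csSup (hLip 1 one_pos) ⟨x, hx, x', hx', h, rfl⟩
    rwa [div_le_iff₀ (by linarith)] at this
  obtain ⟨M, hM, hT2⟩ : ∃ M : ℝ, 0 ≤ M ∧
      ∀ x ∈ S, ∀ x' ∈ S, ‖x - x'‖ < 1 → ‖T x - T x'‖ ≤ M := by
    obtain ⟨e, he, hu⟩ := hT.1 1 one_pos
    obtain ⟨K, hK⟩ := hLip e he
    refine ⟨max 1 K, by positivity, ?_⟩
    intro x hx x' hx' h
    rcases le_total ‖x - x'‖ e with h1 | h1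
    · exact (hu x hx x' hx' h1).trans (le_max_left _ _)
    · have := hK ⟨x, hx, x', hx', h1, rfl⟩
      have hpos : 0 < ‖x - x'‖ := by linarith
      rw [div_le_iff₀ hpos] at this
      have h2 : 0 ≤ max 1 K := by positivity
      have h3 := le_max_right 1 K
      nlinarith
  -- the composed map
  set U : X → Y₀ := fun x => ⟨P (T x), hmem _⟩ with hU
  have hUT : ∀ x x', ‖U x - U x'‖ ≤ ‖P‖ * ‖T x - T x'‖ := by
    intro x x'
    have : ‖U x - U x'‖ = ‖P (T x - T x')‖ := by
      rw [map_sub, Submodule.coe_norm, Submodule.coe_sub]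
    rw [this]; exact P.le_opNorm _
  have hU1 : ∀ x ∈ S, ∀ x' ∈ S, 1 ≤ ‖x - x'‖ → ‖U x - U x'‖ ≤ (‖P‖ * Ld T S 1) * ‖x - x'‖ := by
    intro x hx x' hx' h
    have h1 := mul_le_mul_of_nonneg_left (hT1 x hx x' hx' h) (norm_nonneg P)
    have h2 := hUT x x'
    linarith
  have hU2 : ∀ x ∈ S, ∀ x' ∈ S, ‖x - x'‖ < 1 → ‖U x - U x'‖ ≤ ‖P‖ * M := by
    intro x hx x' hx' h
    have h1 := mul_le_mul_of_nonneg_left (hT2 x hx x' hx' h) (norm_nonneg P)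
    have h2 := hUT x x'
    linarith
  have hPM : 0 ≤ ‖P‖ * M := by positivity
  have hsub : ∀ d, CoLipSet T S d ⊆ CoLipSet U S d := by
    rintro d c ⟨hc, h⟩
    refine ⟨hc, ?_⟩
    intro r hr x hx y hy
    obtain ⟨p, hp, hTp⟩ := h r hr x hx (T x + ((y - U x : Y₀) : Y)) (by
      rw [add_sub_cancel_left]; exact hy)
    refine ⟨p, hp, ?_⟩
    apply Subtype.ext
    simp only [hU]
    rw [hTp, map_add, hproj _ (y - U x).2]
    simp [hU]
  have hbdd : BddAbove {c | ∃ d, 0 < d ∧ c ∈ CoLipSet U S d} := by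
    refine ⟨2 * (‖P‖ * M + ‖P‖ * Ld T S 1), ?_⟩
    rintro c ⟨d, hd, hc, h⟩
    have hn : Nontrivial Y₀ := by
      by_contra h
      rw [not_nontrivial_iff_subsingleton] at h
      exact hY₀ inferInstance
    obtain ⟨x, hx, -⟩ : (0 : Y) ∈ T '' S := by rw [hsurj]; trivial
    have hr1 : (1:ℝ) ≤ max d 1 := le_max_right _ _
    set r := max d 1 with hr
    obtain ⟨w, hw⟩ := exists_norm_eq Y₀ (by positivity : 0 ≤ c * r / 2)
    obtain ⟨p, ⟨hp, hpS⟩, hUp⟩ := h r (le_max_left _ _) x hx (U x + w) (by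
      rw [add_sub_cancel_left, hw]
      have : 0 < c * r := by positivity
      linarith)
    rw [mem_closedBall, dist_eq_norm] at hp
    have e : ‖U p - U x‖ = c * r / 2 := by rw [hUp, add_sub_cancel_left, hw]
    have b : ‖U p - U x‖ ≤ ‖P‖ * M + (‖P‖ * Ld T S 1) * r := by
      rcases le_or_gt 1 ‖p - x‖ with h1 | h1
      · have := hU1 p hpS x hx h1
        nlinarith
      · have := hU2 p hpS x hx h1
        nlinarith
    rw [e] at b
    have : c * r ≤ (2 * (‖P‖ * M + ‖P‖ * Ld T S 1)) * r := by nlinarith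
    exact le_of_mul_le_mul_right this (by linarith)
  set C := sSup {c | ∃ d, 0 < d ∧ c ∈ CoLipSet U S d} with hCdef
  have hC0 : 0 ≤ C := by
    apply Real.sSup_nonneg
    rintro c ⟨d, -, hc⟩
    exact hc.1.le
  have hCC : CT T S ≤ C := by
    apply Real.sSup_le _ hC0
    rintro c ⟨d, hd, rfl⟩
    apply Real.sSup_le _ hC0
    intro c hc
    exact le_csSup hbdd ⟨d, hd, hsub d hc⟩
  have hne : {c | ∃ d, 0 < d ∧ c ∈ CoLipSet U S d}.Nonempty := by
    by_contra h
    rw [Set.not_nonempty_iff_eq_empty] at h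
    rw [h, Real.sSup_empty] at hCdef
    linarith
  refine aux_core hY₀ S U (‖P‖ * Ld T S 1) (‖P‖ * M) hPL hPM hU1 hU2 C (by linarith)
    (isLUB_csSup hne hbdd) t ht ht1 _ δ ?_ hδ
  rw [mul_assoc 12]
  gcongr

end
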